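/- Assume d ≥ 1, L > 0, C_f > 0, and let D = Δ_d = {x ∈ ℝ^d : x_i ≥ 0 for all i, ∑_i x_i = 1} be the standard simplex. Let x⁽⁰⁾ ∈ D, and for each t ≥ 0 set γ_t = 2/(t+2) and σ_t = C_f/(√d·L·(t+2)). Suppose i_t ∈ {1,…,d} satisfies ∇_{i_t} f(x⁽ᵗ⁾) ≤ min_{j} ∇_j f(x⁽ᵗ⁾) + √d·L·σ_t, set s_t = e_{i_t} and x⁽ᵗ⁺¹⁾ = (1 − γ_t)·x⁽ᵗ⁾ + γ_t·s_t. Then f(x⁽ᵗ⁾) − f(x*) ≤ 4·C_f/(t+2) for all t ≥ 1; in particular, f(x⁽ᵀ⁾) − f(x*) ≤ ε for any ε > 0 and any integer T ≥ 4·C_f/ε − 2. -/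

import Mathlib

open scoped RealInnerProductSpace

/-- First-order characterization of convexity: a convex function lies above its tangent planes. -/
theorem ConvexOn.add_inner_gradient_le {E : Type*} [NormedAddCommGroup E]
    [InnerProductSpace ℝ E] [CompleteSpace E] {s : Set E} {f : E → ℝ} {g x y : E}
    (hf : ConvexOn ℝ s f) (hx : x ∈ s) (hy : y ∈ s) (hg : HasGradientAt f g x) :
    f x + ⟪g, y - x⟫ ≤ f y := by
  have hline : HasDerivAt (fun r : ℝ => f (AffineMap.lineMap x y r)) ⟪g, y - x⟫ 0 := by
    have h1 : HasDerivAt (fun r : ℝ => AffineMap.lineMap x y r) (y - x) (0 : ℝ) :=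
      AffineMap.hasDerivAt_lineMap
    have h2 : HasFDerivAt f (InnerProductSpace.toDual ℝ E g) (AffineMap.lineMap x y (0 : ℝ)) := by
      simpa using hg.hasFDerivAt
    simpa [Function.comp_def] using h2.comp_hasDerivAt (0 : ℝ) h1
  have hc := hf.comp_affineMap (AffineMap.lineMap (k := ℝ) x y)
  have h := hc.le_slope_of_hasDerivAt (x := 0) (y := 1) (by simpa using hx) (by simpa using hy)
    one_pos hline
  simp [slope_def_field] at h
  linarith

/-- A coordinate which is within `δ` of the smallest one is within `δ` of every average over the
standard simplex. -/
theorem le_inner_add_of_mem_simplex {ι : Type*} [Fintype ι] {g y : EuclideanSpace ℝ ι} {i : ι}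
    {δ : ℝ} (hi : ∀ j, g i ≤ g j + δ) (hy : ∀ j, 0 ≤ y j) (hsum : ∑ j, y j = 1) :
    g i ≤ ⟪y, g⟫ + δ := by
  calc g i = ∑ j, y j * g i := by rw [← Finset.sum_mul, hsum, one_mul]
    _ ≤ ∑ j, y j * (g j + δ) :=
      Finset.sum_le_sum fun j _ => mul_le_mul_of_nonneg_left (hi j) (hy j)
    _ = ⟪y, g⟫ + δ := by
      simp only [mul_add, Finset.sum_add_distrib, ← Finset.sum_mul, hsum, one_mul,
        PiLp.inner_apply]
      simp [mul_comm]

/-- The `O(1 / t)` rate for sequences obeying the Frank-Wolfe recursion. -/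
theorem le_div_of_frankWolfe_recursion {h : ℕ → ℝ} {C : ℝ} (hC : 0 ≤ C)
    (hrec : ∀ t : ℕ, h (t + 1) ≤ (1 - 2 / ((t : ℝ) + 2)) * h t + (2 / ((t : ℝ) + 2)) ^ 2 * C)
    {t : ℕ} (ht : 1 ≤ t) : h t ≤ 4 * C / ((t : ℝ) + 2) := by
  induction t, ht using Nat.le_induction with
  | base =>
    have h0 := hrec 0
    norm_num at h0 ⊢
    linarith
  | succ t _ ih =>
    have hγ : 0 ≤ 1 - 2 / ((t : ℝ) + 2) := by
      rw [sub_nonneg, div_le_one (by positivity)]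
      linarith [(Nat.cast_nonneg t : (0 : ℝ) ≤ t)]
    calc h (t + 1) ≤ (1 - 2 / ((t : ℝ) + 2)) * h t + (2 / ((t : ℝ) + 2)) ^ 2 * C := hrec t
      _ ≤ (1 - 2 / ((t : ℝ) + 2)) * (4 * C / ((t : ℝ) + 2)) + (2 / ((t : ℝ) + 2)) ^ 2 * C := by
        gcongr
      _ = 4 * C * (((t : ℝ) + 1) / ((t : ℝ) + 2) ^ 2) := by
        field_simp
        ring
      _ ≤ 4 * C * (1 / (((t + 1 : ℕ) : ℝ) + 2)) := by
        refine mul_le_mul_of_nonneg_left ?_ (by positivity)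
        rw [div_le_div_iff₀ (by positivity) (by positivity)]
        push_cast
        nlinarith
      _ = 4 * C / (((t + 1 : ℕ) : ℝ) + 2) := by ring

theorem quantum_frank_wolfe_simplex {d : ℕ} (hd : 1 ≤ d)
    (L Cf : ℝ) (hL : 0 < L) (hCf : 0 < Cf)
    (f : EuclideanSpace ℝ (Fin d) → ℝ)
    (f' : EuclideanSpace ℝ (Fin d) → EuclideanSpace ℝ (Fin d))
    (hconv : ConvexOn ℝ Set.univ f)
    (hgrad : ∀ x, HasGradientAt f (f' x) x)
    (hlip : ∀ x y, ‖f' x - f' y‖ ≤ L * ‖x - y‖)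
    (D : Set (EuclideanSpace ℝ (Fin d)))
    (hD : D = {x : EuclideanSpace ℝ (Fin d) | (∀ i, 0 ≤ x i) ∧ (∑ i, x i) = 1})
    (hcurv : ∀ x ∈ D, ∀ s ∈ D, ∀ β ∈ Set.Icc (0:ℝ) 1,
      f (x + β • (s - x)) ≤ f x + β * ⟪s - x, f' x⟫ + β ^ 2 / 2 * Cf)
    (xstar : EuclideanSpace ℝ (Fin d)) (hxstar : xstar ∈ D)
    (hmin : ∀ z ∈ D, f xstar ≤ f z)
    (x : ℕ → EuclideanSpace ℝ (Fin d)) (idx : ℕ → Fin d)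
    (hx0 : x 0 ∈ D)
    (hsel : ∀ t : ℕ, ∀ j : Fin d, f' (x t) (idx t) ≤ f' (x t) j +
      Real.sqrt d * L * (Cf / (Real.sqrt d * L * ((t : ℝ) + 2))))
    (hupd : ∀ t : ℕ, x (t + 1) = (1 - 2 / ((t : ℝ) + 2)) • x t +
      (2 / ((t : ℝ) + 2)) • (EuclideanSpace.single (idx t) (1:ℝ))) :
    (∀ t : ℕ, 1 ≤ t → f (x t) - f xstar ≤ 4 * Cf / ((t : ℝ) + 2)) ∧
    (∀ ε : ℝ, 0 < ε → ∀ T : ℕ, 1 ≤ T → 4 * Cf / ε - 2 ≤ (T : ℝ) →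
      f (x T) - f xstar ≤ ε) := by
  subst hD
  have hγ : ∀ t : ℕ, 2 / ((t : ℝ) + 2) ∈ Set.Icc (0 : ℝ) 1 := fun t =>
    ⟨by positivity, by
      rw [div_le_one (by positivity)]
      linarith [(Nat.cast_nonneg t : (0 : ℝ) ≤ t)]⟩
  have hvert : ∀ i : Fin d, EuclideanSpace.single i (1 : ℝ) ∈
      {x : EuclideanSpace ℝ (Fin d) | (∀ i, 0 ≤ x i) ∧ (∑ i, x i) = 1} := by
    refine fun i => ⟨fun j => ?_, by simp⟩
    rw [PiLp.single_apply]
    split_ifs <;> norm_num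
  have hmem : ∀ t, x t ∈
      {x : EuclideanSpace ℝ (Fin d) | (∀ i, 0 ≤ x i) ∧ (∑ i, x i) = 1} := by
    intro t
    induction t with
    | zero => exact hx0
    | succ t ih =>
      obtain ⟨hγ0, hγ1⟩ := hγ t
      rw [hupd]
      refine ⟨fun j => ?_, ?_⟩
      · exact add_nonneg (mul_nonneg (sub_nonneg.2 hγ1) (ih.1 j))
          (mul_nonneg hγ0 ((hvert (idx t)).1 j))
      · simp only [PiLp.add_apply, PiLp.smul_apply, smul_eq_mul, Finset.sum_add_distrib,
          ← Finset.mul_sum, ih.2, (hvert (idx t)).2]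
        ring
  have hrec : ∀ t : ℕ, f (x (t + 1)) - f xstar ≤
      (1 - 2 / ((t : ℝ) + 2)) * (f (x t) - f xstar) + (2 / ((t : ℝ) + 2)) ^ 2 * Cf := by
    intro t
    have hδ : Real.sqrt d * L * (Cf / (Real.sqrt d * L * ((t : ℝ) + 2))) =
        2 / ((t : ℝ) + 2) / 2 * Cf := by
      have hd0 : (0 : ℝ) < d := by exact_mod_cast hd
      have hs := Real.sqrt_pos.2 hd0
      field_simp
    have hlmo := le_inner_add_of_mem_simplex (hsel t) hxstar.1 hxstar.2
    rw [hδ] at hlmo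
    have htan := hconv.add_inner_gradient_le (Set.mem_univ (x t)) (Set.mem_univ xstar)
      (hgrad (x t))
    rw [real_inner_comm, inner_sub_left] at htan
    have hstep := hcurv (x t) (hmem t) _ (hvert (idx t)) _ (hγ t)
    have hx : x t + (2 / ((t : ℝ) + 2)) • (EuclideanSpace.single (idx t) (1 : ℝ) - x t) =
        x (t + 1) := by
      rw [hupd]
      module
    rw [hx, inner_sub_left, EuclideanSpace.inner_single_left, map_one, one_mul] at hstep
    have hgap : f' (x t) (idx t) - ⟪x t, f' (x t)⟫ ≤
        f xstar - f (x t) + 2 / ((t : ℝ) + 2) / 2 * Cf := by linarith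
    linarith [mul_le_mul_of_nonneg_left hgap (hγ t).1]
  have hrate : ∀ t : ℕ, 1 ≤ t → f (x t) - f xstar ≤ 4 * Cf / ((t : ℝ) + 2) := fun t ht =>
    le_div_of_frankWolfe_recursion (h := fun t => f (x t) - f xstar) hCf.le hrec ht
  refine ⟨hrate, fun ε hε T hT hTε => (hrate T hT).trans ?_⟩
  rw [div_le_comm₀ (by positivity) hε]
  linarith
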